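/- arXiv:2212.13250 — 2 statements merged into one kernel-verified Lean document; each statement's English description precedes it below -/
import Mathlib

section
/- With Θ = A = ℝ and loss ℓ(θ,a) = |θ-a| if |θ-a| ∈ ℚ and 0 otherwise: for every Borel probability measure μ on ℝ that is supported on a countable set (i.e., there is a countable S ⊆ ℝ with μ(S) = 1), the worst-case risk is infinite: ⨆_{θ ∈ ℝ} ∫⁻_ℝ ℓ(θ,a) μ(da) = ∞ (Lebesgue integral in [0,∞]). -/
open MeasureTheory

open Classical in
/-- The loss `ℓ(θ,a) = |θ - a|` if `|θ - a| ∈ ℚ`, and `0` otherwise, valued in `[0,∞]`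
(all values are in fact finite). -/
noncomputable def loss (θ a : ℝ) : ENNReal :=
  if ∃ q : ℚ, |θ - a| = (q : ℝ) then ENNReal.ofReal |θ - a| else 0

theorem exists_measure_singleton_ne_zero_of_countable {α : Type*} [MeasurableSpace α]
    {μ : Measure α} {S : Set α} (hS : S.Countable) (hμS : μ S ≠ 0) : ∃ a, μ {a} ≠ 0 := by
  by_contra! h
  refine hμS ?_
  rw [← Set.biUnion_of_singleton S]
  exact (measure_biUnion_null_iff hS).2 fun a _ => h a

theorem loss_add_natCast (a : ℝ) (n : ℕ) : loss (a + n) a = n := by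
  have h : |a + n - a| = (n : ℝ) := by simp
  rw [loss, if_pos ⟨n, by simp⟩, h, ENNReal.ofReal_natCast]

theorem natCast_mul_measure_singleton_le_lintegral_loss (μ : Measure ℝ) (a : ℝ) (n : ℕ) :
    n * μ {a} ≤ ∫⁻ x, loss (a + n) x ∂μ := by
  rw [← loss_add_natCast a n, ← lintegral_singleton]
  exact setLIntegral_le_lintegral _ _

/-- Every randomized procedure supported on a countable set has infinite worst-case risk. -/
theorem stmt5 (μ : Measure ℝ) (hμ : IsProbabilityMeasure μ)
    (hc : ∃ S : Set ℝ, S.Countable ∧ μ S = 1) :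
    (⨆ θ : ℝ, ∫⁻ a, loss θ a ∂μ) = ⊤ := by
  obtain ⟨S, hS, hμS⟩ := hc
  obtain ⟨a, ha⟩ := exists_measure_singleton_ne_zero_of_countable hS (hμS.trans_ne one_ne_zero)
  rw [eq_top_iff, ← ENNReal.top_mul ha, ← ENNReal.iSup_natCast, ENNReal.iSup_mul]
  exact iSup_le fun n => (natCast_mul_measure_singleton_le_lintegral_loss μ a n).trans
    (le_iSup (fun θ : ℝ => ∫⁻ x, loss θ x ∂μ) (a + n))
end

section
/- With Θ = A = ℝ and loss ℓ(θ,a) = |θ-a| if |θ-a| ∈ ℚ and 0 otherwise: for every Borel probability measure π on ℝ there exists an action a ∈ ℝ such that ∫⁻_ℝ ℓ(θ,a) π(dθ) = 0. Consequently, ⨅_{a ∈ ℝ} ∫⁻_ℝ ℓ(θ,a) π(dθ) = 0 for every Borel probability measure π on ℝ. -/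
open MeasureTheory

/-- The atoms of an s-finite measure form a countable set. -/
theorem countable_setOf_measure_singleton_pos {α : Type*} [MeasurableSpace α]
    [MeasurableSingletonClass α] (μ : Measure α) [SFinite μ] :
    {x : α | 0 < μ {x}}.Countable :=
  Measure.countable_meas_pos_of_disjoint_iUnion (fun x => measurableSet_singleton x)
    fun _ _ hxy => Set.disjoint_singleton.2 hxy

/-- An s-finite measure on `ℝ` has a rational coset of measure zero. -/
theorem exists_measure_range_add_ratCast_eq_zero (μ : Measure ℝ) [SFinite μ] :
    ∃ a : ℝ, μ (Set.range fun q : ℚ => a + (q : ℝ)) = 0 := by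
  have hcount : (⋃ q : ℚ, (fun x : ℝ => x - q) '' {x : ℝ | 0 < μ {x}}).Countable :=
    Set.countable_iUnion fun q => (countable_setOf_measure_singleton_pos μ).image _
  obtain ⟨a, ha⟩ := (hcount.dense_compl ℝ).nonempty
  refine ⟨a, ?_⟩
  rw [← Set.iUnion_singleton_eq_range, measure_iUnion_null_iff]
  intro q
  by_contra hq
  exact ha (Set.mem_iUnion.2 ⟨q, a + q, pos_iff_ne_zero.2 hq, add_sub_cancel_right a (q : ℝ)⟩)

theorem loss_eq_zero_of_notMem_range {θ a : ℝ}
    (h : θ ∉ Set.range fun q : ℚ => a + (q : ℝ)) : loss θ a = 0 := by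
  refine if_neg ?_
  rintro ⟨q, hq⟩
  rcases abs_choice (θ - a) with h' | h' <;> rw [h'] at hq
  · exact h ⟨q, by linarith⟩
  · exact h ⟨-q, by push_cast; linarith⟩

/-- For every Borel probability prior `π` on `ℝ` there is an action with zero Bayes risk;
consequently the infimum of the Bayes risk over actions is `0`. -/
theorem stmt6 (π : Measure ℝ) (hπ : IsProbabilityMeasure π) :
    (∃ a : ℝ, ∫⁻ θ, loss θ a ∂π = 0) ∧ (⨅ a : ℝ, ∫⁻ θ, loss θ a ∂π) = 0 := by
  obtain ⟨a, ha⟩ := exists_measure_range_add_ratCast_eq_zero π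
  have hrisk : ∫⁻ θ, loss θ a ∂π = 0 := by
    refine lintegral_eq_zero_of_ae_eq_zero ?_
    filter_upwards [measure_eq_zero_iff_ae_notMem.1 ha] with θ hθ
    exact loss_eq_zero_of_notMem_range hθ
  exact ⟨⟨a, hrisk⟩, le_antisymm (iInf_le_of_le a hrisk.le) zero_le⟩
end
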